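/- Let ψ be a unit vector in ℂ^{d_A} ⊗ ℂ^{d_B}, let ρ_{AB} = |ψ⟩⟨ψ|, and let ρ_A = Tr_B ρ_{AB}, ρ_B = Tr_A ρ_{AB} be its marginals. Then for every α ∈ (0,1) ∪ (1,3/2), the Petz Rényi divergence satisfies D̄_α(ρ_{AB} ‖ ρ_A ⊗ ρ_B) = 2·S_{3 − 2α}(ρ_A). -/

import Mathlib

open scoped Kronecker
open Matrix

/-- Partial trace over the second (B) system. -/
noncomputable def ptraceB {A B : Type*} [Fintype B]
    (ρ : Matrix (A × B) (A × B) ℂ) : Matrix A A ℂ :=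
  Matrix.of fun a a' => ∑ b, ρ (a, b) (a', b)

/-- Partial trace over the first (A) system. -/
noncomputable def ptraceA {A B : Type*} [Fintype A]
    (ρ : Matrix (A × B) (A × B) ℂ) : Matrix B B ℂ :=
  Matrix.of fun b b' => ∑ a, ρ (a, b) (a, b')

/-- Real power of a Hermitian matrix via spectral decomposition, convention `0^r = 0`
on the kernel; junk value `0` for non-Hermitian matrices. -/
noncomputable def mPow {n : Type*} [Fintype n] [DecidableEq n]
    (M : Matrix n n ℂ) (r : ℝ) : Matrix n n ℂ :=
  if h : M.IsHermitian then
    (h.eigenvectorUnitary : Matrix n n ℂ) *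
      Matrix.diagonal
        (fun i => ((if h.eigenvalues i = 0 then (0 : ℝ) else h.eigenvalues i ^ r : ℝ) : ℂ)) *
      star (h.eigenvectorUnitary : Matrix n n ℂ)
  else 0

/-- Petz Rényi divergence `D̄_α(ρ‖σ) = (α−1)⁻¹ log Tr[ρ^α σ^{1−α}]`. -/
noncomputable def petzRenyiDiv {n : Type*} [Fintype n] [DecidableEq n]
    (α : ℝ) (ρ σ : Matrix n n ℂ) : ℝ :=
  (α - 1)⁻¹ * Real.log (Matrix.trace (mPow ρ α * mPow σ (1 - α))).re

/-- Rényi entropy of order `β`, `S_β(ρ) = (1−β)⁻¹ log Tr[ρ^β]`. -/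
noncomputable def matrixRenyiEntropy {n : Type*} [Fintype n] [DecidableEq n]
    (β : ℝ) (ρ : Matrix n n ℂ) : ℝ :=
  (1 - β)⁻¹ * Real.log (Matrix.trace (mPow ρ β)).re

/-- The scalar function underlying `mPow`: `x ↦ x ^ r` with the convention `0 ^ r = 0`. -/
noncomputable def supportRpow (r x : ℝ) : ℝ := if x = 0 then 0 else x ^ r

lemma supportRpow_mul {x y : ℝ} (r : ℝ) (hx : 0 ≤ x) (hy : 0 ≤ y) :
    supportRpow r (x * y) = supportRpow r x * supportRpow r y := by
  unfold supportRpow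
  by_cases h : x = 0
  · simp [h]
  by_cases h' : y = 0
  · simp [h']
  simp [h, h', Real.mul_rpow hx hy]

lemma supportRpow_mul_supportRpow_mul_self {x : ℝ} (s : ℝ) (hx : 0 ≤ x) :
    supportRpow s x * supportRpow s x * x = supportRpow (2 * s + 1) x := by
  unfold supportRpow
  split_ifs with h
  · simp
  · have hx' : 0 < x := lt_of_le_of_ne hx (Ne.symm h)
    rw [two_mul, Real.rpow_add hx', Real.rpow_add hx', Real.rpow_one]

lemma supportRpow_of_mul_self_eq {x : ℝ} (r : ℝ) (hx : x * x = x) : supportRpow r x = x := by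
  rcases IsIdempotentElem.iff_eq_zero_or_one.mp hx with rfl | rfl <;> simp [supportRpow]

section SpectralPower

open scoped ComplexOrder

variable {m n : Type*} [Fintype m] [DecidableEq m] [Fintype n] [DecidableEq n]

/-- Intertwining relations between unitarily diagonalized matrices pass to functions of them. -/
lemma intertwine_diagonal_map (f : ℝ → ℝ) {U : Matrix m m ℂ} {V : Matrix n n ℂ}
    (hU : U ∈ unitaryGroup m ℂ) (hV : V ∈ unitaryGroup n ℂ) {d : m → ℝ} {e : n → ℝ}
    {X : Matrix m n ℂ}
    (h : X * (V * diagonal (fun i => (e i : ℂ)) * star V) =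
      U * diagonal (fun i => (d i : ℂ)) * star U * X) :
    X * (V * diagonal (fun i => (f (e i) : ℂ)) * star V) =
      U * diagonal (fun i => (f (d i) : ℂ)) * star U * X := by
  have hU1 : star U * U = 1 := mem_unitaryGroup_iff'.mp hU
  have hU2 : U * star U = 1 := mem_unitaryGroup_iff.mp hU
  have hV1 : star V * V = 1 := mem_unitaryGroup_iff'.mp hV
  have hV2 : V * star V = 1 := mem_unitaryGroup_iff.mp hV
  obtain ⟨Y, rfl⟩ : ∃ Y, X = U * Y * star V := ⟨star U * X * V, by
    rw [← Matrix.mul_assoc, ← Matrix.mul_assoc, hU2, Matrix.one_mul, Matrix.mul_assoc, hV2,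
      Matrix.mul_one]⟩
  have left (D : Matrix n n ℂ) :
      U * Y * star V * (V * D * star V) = U * (Y * D) * star V := by
    calc _ = U * Y * (star V * V) * D * star V := by simp only [Matrix.mul_assoc]
      _ = _ := by rw [hV1, Matrix.mul_one]; simp only [Matrix.mul_assoc]
  have right (D : Matrix m m ℂ) :
      U * D * star U * (U * Y * star V) = U * (D * Y) * star V := by
    calc _ = U * D * (star U * U) * Y * star V := by simp only [Matrix.mul_assoc]
      _ = _ := by rw [hU1, Matrix.mul_one]; simp only [Matrix.mul_assoc]
  rw [left, right] at h ⊢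
  have key : Y * diagonal (fun i => (e i : ℂ)) = diagonal (fun i => (d i : ℂ)) * Y := by
    have cancel (Z : Matrix m n ℂ) : star U * (U * Z * star V) * V = Z := by
      calc _ = (star U * U) * Z * (star V * V) := by simp only [Matrix.mul_assoc]
        _ = Z := by rw [hU1, hV1, Matrix.one_mul, Matrix.mul_one]
    rw [← cancel (Y * _), h, cancel]
  congr 2
  ext i j
  have hij := congrFun (congrFun key i) j
  rw [mul_diagonal, diagonal_mul] at hij ⊢
  by_cases hY : Y i j = 0
  · simp [hY]
  · rw [mul_comm] at hij
    have : e j = d i := by exact_mod_cast mul_right_cancel₀ hY hij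
    rw [this, mul_comm]

lemma eq_eigenvectorUnitary_mul_diagonal {M : Matrix n n ℂ} (h : M.IsHermitian) :
    M = (h.eigenvectorUnitary : Matrix n n ℂ) * diagonal (fun i => (h.eigenvalues i : ℂ)) *
      star (h.eigenvectorUnitary : Matrix n n ℂ) := by
  conv_lhs => rw [h.spectral_theorem, Unitary.conjStarAlgAut_apply]
  rfl

lemma mPow_eq {M : Matrix n n ℂ} (h : M.IsHermitian) (r : ℝ) :
    mPow M r = (h.eigenvectorUnitary : Matrix n n ℂ) *
      diagonal (fun i => (supportRpow r (h.eigenvalues i) : ℂ)) *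
      star (h.eigenvectorUnitary : Matrix n n ℂ) := by
  rw [mPow, dif_pos h]
  rfl

/-- `mPow` may be computed from any unitary diagonalization. -/
lemma mPow_eq_of_eq_diagonal {M U : Matrix n n ℂ} (hM : M.IsHermitian)
    (hU : U ∈ unitaryGroup n ℂ) {d : n → ℝ}
    (h : M = U * diagonal (fun i => (d i : ℂ)) * star U) (r : ℝ) :
    mPow M r = U * diagonal (fun i => (supportRpow r (d i) : ℂ)) * star U := by
  rw [mPow_eq hM]
  simpa using intertwine_diagonal_map (supportRpow r) hU hM.eigenvectorUnitary.2 (X := 1)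
    (by rw [← eq_eigenvectorUnitary_mul_diagonal hM, ← h, Matrix.one_mul, Matrix.mul_one])

lemma mul_mPow_of_intertwine {M : Matrix m m ℂ} {N : Matrix n n ℂ} (hM : M.IsHermitian)
    (hN : N.IsHermitian) {X : Matrix m n ℂ} (h : X * N = M * X) (r : ℝ) :
    X * mPow N r = mPow M r * X := by
  rw [mPow_eq hM, mPow_eq hN]
  refine intertwine_diagonal_map _ hM.eigenvectorUnitary.2 hN.eigenvectorUnitary.2 ?_
  rwa [← eq_eigenvectorUnitary_mul_diagonal, ← eq_eigenvectorUnitary_mul_diagonal]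

lemma mPow_transpose {M : Matrix n n ℂ} (h : M.IsHermitian) (r : ℝ) :
    mPow Mᵀ r = (mPow M r)ᵀ := by
  set U : Matrix n n ℂ := (h.eigenvectorUnitary : Matrix n n ℂ) with hUdef
  have hs : star (star U)ᵀ = Uᵀ := by
    ext i j
    simp [star_apply]
  have hU : (star U)ᵀ ∈ unitaryGroup n ℂ := by
    rw [mem_unitaryGroup_iff, hs, ← transpose_mul,
      mem_unitaryGroup_iff.mp h.eigenvectorUnitary.2, transpose_one]
  rw [mPow_eq_of_eq_diagonal h.transpose hU (d := h.eigenvalues) ?_, mPow_eq h, hs]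
  · simp only [transpose_mul, diagonal_transpose, Matrix.mul_assoc, hUdef]
  · rw [hs]
    conv_lhs => rw [eq_eigenvectorUnitary_mul_diagonal h]
    simp only [transpose_mul, diagonal_transpose, Matrix.mul_assoc, hUdef]

lemma mPow_kronecker {M : Matrix m m ℂ} {N : Matrix n n ℂ} (hM : M.PosSemidef)
    (hN : N.PosSemidef) (r : ℝ) : mPow (M ⊗ₖ N) r = mPow M r ⊗ₖ mPow N r := by
  have hM' := hM.isHermitian
  have hN' := hN.isHermitian
  have hs : star ((hM'.eigenvectorUnitary : Matrix m m ℂ) ⊗ₖ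
      (hN'.eigenvectorUnitary : Matrix n n ℂ)) =
      star (hM'.eigenvectorUnitary : Matrix m m ℂ) ⊗ₖ
      star (hN'.eigenvectorUnitary : Matrix n n ℂ) := conjTranspose_kronecker _ _
  rw [mPow_eq_of_eq_diagonal (hM.kronecker hN).isHermitian
    (kronecker_mem_unitary hM'.eigenvectorUnitary.2 hN'.eigenvectorUnitary.2)
    (d := fun p => hM'.eigenvalues p.1 * hN'.eigenvalues p.2) ?_, mPow_eq hM', mPow_eq hN', hs]
  · simp_rw [supportRpow_mul r (hM.eigenvalues_nonneg _) (hN.eigenvalues_nonneg _),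
      Complex.ofReal_mul, mul_kronecker_mul, diagonal_kronecker_diagonal]
  · rw [hs]
    conv_lhs =>
      rw [eq_eigenvectorUnitary_mul_diagonal hM', eq_eigenvectorUnitary_mul_diagonal hN']
    simp_rw [mul_kronecker_mul, diagonal_kronecker_diagonal, Complex.ofReal_mul]

lemma mPow_of_mul_self_eq {M : Matrix n n ℂ} (hM : M.IsHermitian) (h : M * M = M) (r : ℝ) :
    mPow M r = M := by
  have hev (i : n) : hM.eigenvalues i * hM.eigenvalues i = hM.eigenvalues i := by
    have h1 := hM.mulVec_eigenvectorBasis i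
    have h2 : M *ᵥ (M *ᵥ _) = M *ᵥ _ := congrArg (M *ᵥ ·) h1
    rw [mulVec_mulVec, h, mulVec_smul, h1, smul_smul] at h2
    have hne : (hM.eigenvectorBasis i).ofLp ≠ 0 := fun h0 =>
      hM.eigenvectorBasis.orthonormal.ne_zero i (by ext j; exact congrFun h0 j)
    exact (smul_left_injective ℝ hne h2).symm
  rw [mPow_eq hM]
  simp_rw [supportRpow_of_mul_self_eq r (hev _)]
  exact (eq_eigenvectorUnitary_mul_diagonal hM).symm

lemma mPow_mul_mPow_mul_self {M : Matrix n n ℂ} (hM : M.PosSemidef) (s : ℝ) :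
    mPow M s * mPow M s * M = mPow M (2 * s + 1) := by
  have h := hM.isHermitian
  set U : Matrix n n ℂ := (h.eigenvectorUnitary : Matrix n n ℂ) with hUdef
  have hU : star U * U = 1 := mem_unitaryGroup_iff'.mp h.eigenvectorUnitary.2
  have conj_mul (D E : Matrix n n ℂ) :
      (U * D * star U) * (U * E * star U) = U * (D * E) * star U := by
    calc _ = U * D * (star U * U) * E * star U := by simp only [Matrix.mul_assoc]
      _ = _ := by rw [hU, Matrix.mul_one]; simp only [Matrix.mul_assoc]
  conv_lhs =>
    enter [2]
    rw [eq_eigenvectorUnitary_mul_diagonal h]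
  rw [mPow_eq h, mPow_eq h, ← hUdef, conj_mul, conj_mul, diagonal_mul_diagonal,
    diagonal_mul_diagonal]
  simp_rw [← Complex.ofReal_mul,
    supportRpow_mul_supportRpow_mul_self s (hM.eigenvalues_nonneg _)]

end SpectralPower

section PureState

open scoped ComplexOrder

variable {A B : Type*}

lemma ptraceB_vecMulVec [Fintype B] (ψ : A × B → ℂ) :
    ptraceB (vecMulVec ψ (star ψ)) =
      (of fun a b => ψ (a, b)) * (of fun a b => ψ (a, b) : Matrix A B ℂ)ᴴ := by
  ext a a'
  simp [ptraceB, vecMulVec_apply, mul_apply]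

lemma ptraceA_vecMulVec [Fintype A] (ψ : A × B → ℂ) :
    ptraceA (vecMulVec ψ (star ψ)) =
      ((of fun a b => ψ (a, b) : Matrix A B ℂ)ᴴ * (of fun a b => ψ (a, b)))ᵀ := by
  ext b b'
  simp [ptraceA, vecMulVec_apply, mul_apply, mul_comm]

lemma trace_vecMulVec_mul_kronecker [Fintype A] [Fintype B] (ψ : A × B → ℂ)
    (P : Matrix A A ℂ) (Q : Matrix B B ℂ) :
    (vecMulVec ψ (star ψ) * (P ⊗ₖ Q)).trace =
      (P * ((of fun a b => ψ (a, b)) * Qᵀ) * (of fun a b => ψ (a, b) : Matrix A B ℂ)ᴴ).trace := by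
  rw [trace_mul_comm]
  simp only [trace, diag_apply, mul_apply, vecMulVec_apply, kroneckerMap_apply, of_apply,
    transpose_apply, conjTranspose_apply, Pi.star_apply, Fintype.sum_prod_type, Finset.mul_sum,
    Finset.sum_mul]
  refine Finset.sum_congr rfl fun a _ => Finset.sum_congr rfl fun b _ =>
    Finset.sum_congr rfl fun a' _ => Finset.sum_congr rfl fun b' _ => ?_
  ring

lemma trace_mPow_mul_mPow_ptrace [Fintype A] [DecidableEq A] [Fintype B] [DecidableEq B]
    (ψ : A × B → ℂ) (hψ : ∑ z, ‖ψ z‖ ^ 2 = 1) (α : ℝ) :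
    (mPow (vecMulVec ψ (star ψ)) α * mPow (ptraceB (vecMulVec ψ (star ψ)) ⊗ₖ
      ptraceA (vecMulVec ψ (star ψ))) (1 - α)).trace =
      (mPow (ptraceB (vecMulVec ψ (star ψ))) (3 - 2 * α)).trace := by
  rw [ptraceB_vecMulVec, ptraceA_vecMulVec]
  set X : Matrix A B ℂ := of fun a b => ψ (a, b) with hX
  have hψ' : star ψ ⬝ᵥ ψ = 1 := by
    have := congrArg (fun x : ℝ => (x : ℂ)) hψ
    simpa [dotProduct, Complex.conj_mul'] using this
  have hA : (X * Xᴴ).PosSemidef := posSemidef_self_mul_conjTranspose X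
  have hB : (Xᴴ * X).PosSemidef := posSemidef_conjTranspose_mul_self X
  have hherm : (vecMulVec ψ (star ψ)).IsHermitian := (posSemidef_vecMulVec_self_star ψ).isHermitian
  have hproj : vecMulVec ψ (star ψ) * vecMulVec ψ (star ψ) = vecMulVec ψ (star ψ) := by
    rw [vecMulVec_mul_vecMulVec, hψ', one_smul]
  rw [mPow_of_mul_self_eq hherm hproj, mPow_kronecker hA hB.transpose,
    trace_vecMulVec_mul_kronecker, mPow_transpose hB.isHermitian, transpose_transpose, ← hX,
    mul_mPow_of_intertwine hA.isHermitian hB.isHermitian (Matrix.mul_assoc X Xᴴ X).symm,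
    ← Matrix.mul_assoc, Matrix.mul_assoc _ X, mPow_mul_mPow_mul_self hA]
  congr 2
  ring

end PureState

/-- Eq. (A24) of the paper: for a pure state `ρ_{AB} = |ψ⟩⟨ψ|` and `α ∈ (0,1)∪(1,3/2)`,
`D̄_α(ρ_{AB} ‖ ρ_A ⊗ ρ_B) = 2·S_{3−2α}(ρ_A)`. -/
theorem petz_renyi_mutual_information_pure_state
    {dA dB : ℕ} (hdA : 0 < dA) (hdB : 0 < dB)
    (ψ : Fin dA × Fin dB → ℂ) (hψ : ∑ z, ‖ψ z‖ ^ 2 = 1)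
    (ρAB : Matrix (Fin dA × Fin dB) (Fin dA × Fin dB) ℂ)
    (hρAB : ρAB = Matrix.vecMulVec ψ (star ψ))
    (α : ℝ) (hα : α ∈ Set.Ioo (0:ℝ) 1 ∪ Set.Ioo 1 (3 / 2)) :
    petzRenyiDiv α ρAB (ptraceB ρAB ⊗ₖ ptraceA ρAB) =
      2 * matrixRenyiEntropy (3 - 2 * α) (ptraceB ρAB) := by
  subst hρAB
  rw [petzRenyiDiv, matrixRenyiEntropy, trace_mPow_mul_mPow_ptrace ψ hψ, ← mul_assoc]
  congr 1
  have hα1 : α - 1 ≠ 0 := by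
    rcases hα with h | h
    · exact (sub_neg.mpr h.2).ne
    · exact (sub_pos.mpr h.1).ne'
  rw [show 1 - (3 - 2 * α) = 2 * (α - 1) by ring]
  field_simp
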